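/- arXiv:1902.07061 — 7 statements merged into one kernel-verified Lean document; each statement's English description precedes it below -/
import Mathlib

section
/- For every integer N ≥ 1, in the formal power series ring ℚ⟦u⟧ one has ∏_{k=N+1}^{2N} (1 − u^k) ≡ 1 − (u^{N+1} − u^{2N+1})/(1 − u) + u^{2N+2}/(2(1 − u)^2) − u^{2N+2}/(2(1 − u^2)) (mod u^{3N+1}). (This is the content of equation (2.5) of Lemma 2.3: the first 3N+1 highest coefficients of {2N}! agree with those of (−1)^N {N}! times the displayed factor, after the normalization {M}! = (−1)^M A^{−M(M+1)} Q_M(u) with u = q^{−1} = A^4.) -/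
open PowerSeries

theorem aux_prod (h : PowerSeries ℚ) (hh : 2 * h = 1) (N M : ℕ) :
    (X : PowerSeries ℚ) ^ (3 * N + 1) ∣
      (∏ k ∈ Finset.Icc (N + 1) (N + M), (1 - (X : PowerSeries ℚ) ^ k)) -
        (1 - X ^ (N + 1) * (∑ i ∈ Finset.range M, X ^ i)
          + h * X ^ (2 * N + 2) * ((∑ i ∈ Finset.range M, X ^ i) ^ 2
            - ∑ i ∈ Finset.range M, (X ^ 2) ^ i)) := by
  induction M with
  | zero => simp
  | succ M ih =>
    rw [← add_assoc, Finset.prod_Icc_succ_top (by omega), Finset.sum_range_succ,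
      Finset.sum_range_succ]
    obtain ⟨c, hc⟩ := ih
    rw [sub_eq_iff_eq_add] at hc
    rw [hc]
    generalize (∑ i ∈ Finset.range M, (X : PowerSeries ℚ) ^ i) = S
    generalize (∑ i ∈ Finset.range M, ((X : PowerSeries ℚ) ^ 2) ^ i) = t
    refine ⟨c * (1 - X ^ (N + M + 1)) - h * X ^ (M + 2) * (S ^ 2 - t), ?_⟩
    linear_combination (-X ^ (2 * N + 2 + M) * S) * hh

/-- Equation (2.5) of Lemma 2.3: in ℚ⟦u⟧, with u = X,
∏_{k=N+1}^{2N} (1 − u^k) ≡ 1 − (u^{N+1} − u^{2N+1})/(1 − u)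
  + u^{2N+2}/(2(1 − u)^2) − u^{2N+2}/(2(1 − u^2))  (mod u^{3N+1}). -/
theorem two_N_factorial_congr (N : ℕ) (hN : 1 ≤ N) :
    (X : PowerSeries ℚ) ^ (3 * N + 1) ∣
      (∏ k ∈ Finset.Icc (N + 1) (2 * N), (1 - (X : PowerSeries ℚ) ^ k)) -
        (1 - (X ^ (N + 1) - X ^ (2 * N + 1)) * (1 - X)⁻¹
          + X ^ (2 * N + 2) * (2 * (1 - X) ^ 2)⁻¹
          - X ^ (2 * N + 2) * (2 * (1 - X ^ 2))⁻¹) := by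
  obtain ⟨h, hh, hC⟩ : ∃ h : PowerSeries ℚ, 2 * h = 1 ∧ h = C (1 / 2 : ℚ) := by
    refine ⟨_, ?_, rfl⟩
    rw [show (2 : PowerSeries ℚ) = C (2 : ℚ) from (map_ofNat C 2).symm, ← map_mul]
    norm_num
  have ha : (1 - X : PowerSeries ℚ) * (1 - X)⁻¹ = 1 := PowerSeries.mul_inv_cancel _ (by simp)
  have hb : (1 - X ^ 2 : PowerSeries ℚ) * (1 - X ^ 2)⁻¹ = 1 :=
    PowerSeries.mul_inv_cancel _ (by simp)
  have h2 : (2 : PowerSeries ℚ)⁻¹ = h := by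
    rw [PowerSeries.inv_eq_iff_mul_eq_one (by rw [map_ofNat]; norm_num), mul_comm]
    exact hh
  have e1 : (2 * (1 - X : PowerSeries ℚ) ^ 2)⁻¹ = h * (1 - X)⁻¹ ^ 2 := by
    rw [PowerSeries.mul_inv_rev, h2, pow_two, PowerSeries.mul_inv_rev]; ring
  have e2 : (2 * (1 - X ^ 2 : PowerSeries ℚ))⁻¹ = h * (1 - X ^ 2)⁻¹ := by
    rw [PowerSeries.mul_inv_rev, h2]; ring
  have hS := mul_neg_geom_sum (X : PowerSeries ℚ) N
  have ht := mul_neg_geom_sum (X ^ 2 : PowerSeries ℚ) N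
  have hp := aux_prod h hh N N
  rw [e1, e2]
  rw [show N + N = 2 * N by ring] at hp
  generalize (∑ i ∈ Finset.range N, (X : PowerSeries ℚ) ^ i) = S at *
  generalize (∑ i ∈ Finset.range N, ((X : PowerSeries ℚ) ^ 2) ^ i) = t at *
  generalize (1 - X : PowerSeries ℚ)⁻¹ = a at *
  generalize (1 - X ^ 2 : PowerSeries ℚ)⁻¹ = b at *
  have hS' : S = (1 - X ^ N) * a := by linear_combination a * hS - S * ha
  have ht' : t = (1 - X ^ (2 * N)) * b := by
    rw [← pow_mul] at ht
    linear_combination b * ht - t * hb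
  obtain ⟨c, hc⟩ := hp
  rw [sub_eq_iff_eq_add] at hc
  rw [hc, hS', ht']
  refine ⟨c + h * X * ((-2 + X ^ N) * a ^ 2 + X ^ N * b), ?_⟩
  ring
end

section
/- For every integer N ≥ 1, in ℚ⟦u⟧ one has Q_{3N+1}(u) · Q_N(u)^3 / (Q_{2N}(u)^3 · (1 − u^{N+1})) ≡ (Q_N(u)/(1 − u^{N+1})) · (1 − u^{2N+1}/(1 − u)) · (1 + 2(u^{N+1} − u^{2N+1})/(1 − u) + 2u^{2N+2}/(1 − u)^2 + u^{2N+2}/(1 − u^2)) (mod u^{3N+1}), where Q_M(u) = ∏_{k=1}^M (1 − u^k). (This is the q-series content of the chain of congruences (3.2)–(3.4): it computes the first 3N+1 highest coefficients of the normalized colored Jones polynomial {3N+1}!{N}!^3/({2N}!^3{N+1}) of a pretzel knot whose three negative twist regions each have at least three half-twists, after the normalization {M}! = (−1)^M A^{−M(M+1)} Q_M(u) with u = q^{−1} = A^4.) -/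
open PowerSeries

/-- Q_M(u) = ∏_{k=1}^M (1 − u^k) in ℚ⟦u⟧. -/
noncomputable def Q (M : ℕ) : PowerSeries ℚ := ∏ k ∈ Finset.Icc 1 M, (1 - PowerSeries.X ^ k)

noncomputable def Pa (a m : ℕ) : PowerSeries ℚ := ∏ k ∈ Finset.range m, (1 - X ^ (a + k))
noncomputable def Sa (m : ℕ) : PowerSeries ℚ := ∑ k ∈ Finset.range m, X ^ k
noncomputable def Ta (m : ℕ) : PowerSeries ℚ := ∑ k ∈ Finset.range m, X ^ (2 * k)

lemma Q_add (a m : ℕ) : Q (a + m) = Q a * Pa (a + 1) m := by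
  induction m with
  | zero => simp [Pa]
  | succ m ih =>
    have : Q (a + (m + 1)) = Q (a + m) * (1 - X ^ (a + m + 1)) := by
      unfold Q
      rw [← add_assoc, Finset.prod_Icc_succ_top (by omega)]
    rw [this, ih, Pa, Pa, Finset.prod_range_succ, mul_assoc, show a + m + 1 = a + 1 + m by ring]

lemma Pa_one (a m : ℕ) : ∃ c : PowerSeries ℚ, Pa a m = 1 - X ^ a * Sa m + X ^ (2 * a) * c := by
  induction m with
  | zero => exact ⟨0, by simp [Pa, Sa]⟩
  | succ m ih =>
    obtain ⟨c, hc⟩ := ih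
    refine ⟨c * (1 - X ^ (a + m)) + X ^ m * Sa m, ?_⟩
    have h1 : Pa a (m + 1) = Pa a m * (1 - X ^ (a + m)) := by simp [Pa, Finset.prod_range_succ]
    have h2 : Sa (m + 1) = Sa m + X ^ m := by simp [Sa, Finset.sum_range_succ]
    rw [h1, h2, hc]; ring

lemma Pa_two (a m : ℕ) : ∃ c : PowerSeries ℚ,
    2 * Pa a m = 2 - 2 * X ^ a * Sa m + X ^ (2 * a) * (Sa m ^ 2 - Ta m) + X ^ (3 * a) * c := by
  induction m with
  | zero => exact ⟨0, by simp [Pa, Sa, Ta]⟩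
  | succ m ih =>
    obtain ⟨c, hc⟩ := ih
    refine ⟨c * (1 - X ^ (a + m)) - X ^ m * (Sa m ^ 2 - Ta m), ?_⟩
    have h1 : Pa a (m + 1) = Pa a m * (1 - X ^ (a + m)) := by simp [Pa, Finset.prod_range_succ]
    have h2 : Sa (m + 1) = Sa m + X ^ m := by simp [Sa, Finset.sum_range_succ]
    have h3 : Ta (m + 1) = Ta m + X ^ (2 * m) := by simp [Ta, Finset.sum_range_succ]
    rw [h1, h2, h3, ← mul_assoc, hc]; ring

lemma Sa_mul (m : ℕ) : Sa m * (1 - X) = 1 - X ^ m := by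
  have := geom_sum_mul_neg (X : PowerSeries ℚ) m
  simpa [Sa] using this

lemma Ta_mul (m : ℕ) : Ta m * (1 - X ^ 2) = 1 - X ^ (2 * m) := by
  have := geom_sum_mul_neg ((X : PowerSeries ℚ) ^ 2) m
  simpa [Ta, pow_mul] using this

lemma cc_pow (k : ℕ) (hk : k ≠ 0) : constantCoeff (1 - (X : PowerSeries ℚ) ^ k) ≠ 0 := by
  simp [hk]

lemma cc_Pa (a m : ℕ) (ha : a ≠ 0) : constantCoeff (Pa a m) ≠ 0 := by
  simp [Pa, map_prod, ha]

lemma cc_Q (m : ℕ) : constantCoeff (Q m) ≠ 0 := by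
  have := Q_add 0 m
  rw [zero_add] at this
  rw [this]
  have h := cc_Pa (0 + 1) m (by simp)
  simpa [Q] using h

lemma two_sq (y s t c p : PowerSeries ℚ)
    (h : 2 * p = 2 - 2 * y * s + y ^ 2 * (s ^ 2 - t) + y ^ 3 * c) :
    y ^ 3 ∣ p ^ 2 * (1 + 2 * y * s + 2 * y ^ 2 * s ^ 2 + y ^ 2 * t) - 1 := by
  have h4 : y ^ 3 ∣ 4 * (p ^ 2 * (1 + 2 * y * s + 2 * y ^ 2 * s ^ 2 + y ^ 2 * t) - 1) := by
    have e : 4 * (p ^ 2 * (1 + 2 * y * s + 2 * y ^ 2 * s ^ 2 + y ^ 2 * t) - 1)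
      = (2 * p) ^ 2 * (1 + 2 * y * s + 2 * y ^ 2 * s ^ 2 + y ^ 2 * t) - 4 := by ring
    rw [e, h]
    refine ⟨(4 * c - 4 * s * (s ^ 2 - t) + y * ((s^2-t) - 2 * s*0 + y * c)^2 - 4 * y * s * c)
      * (1 + 2 * y * s + 2 * y ^ 2 * s ^ 2 + y ^ 2 * t)
      + 8 * s * (2 * s ^ 2 - t) + (-8 * s) * (2 * s ^ 2 + t) 
      + 4 * y * (2 * s ^ 2 - t) * (2 * s ^ 2 + t), ?_⟩
    ring
  have hu : (4 : PowerSeries ℚ) * C (1/4 : ℚ) = 1 := by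
    rw [show (4 : PowerSeries ℚ) = C (4 : ℚ) from (map_ofNat C 4).symm, ← map_mul]; norm_num
  have := h4.mul_left (C (1/4 : ℚ))
  rwa [← mul_assoc, mul_comm (C _) 4, hu, one_mul] at this

theorem normalized_cjp_congr (N : ℕ) (hN : 1 ≤ N) :
    (X : PowerSeries ℚ) ^ (3 * N + 1) ∣
      Q (3 * N + 1) * Q N ^ 3 * (Q (2 * N) ^ 3 * (1 - (X : PowerSeries ℚ) ^ (N + 1)))⁻¹ -
        Q N * (1 - (X : PowerSeries ℚ) ^ (N + 1))⁻¹ *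
          (1 - X ^ (2 * N + 1) * (1 - X)⁻¹) *
          (1 + 2 * (X ^ (N + 1) - X ^ (2 * N + 1)) * (1 - X)⁻¹
            + 2 * X ^ (2 * N + 2) * ((1 - X) ^ 2)⁻¹
            + X ^ (2 * N + 2) * (1 - X ^ 2)⁻¹) := by
  have hQ2 : Q (2 * N) = Q N * Pa (N + 1) N := by rw [two_mul, Q_add]
  have hQ3 : Q (3 * N + 1) = Q N * Pa (N + 1) N * Pa (2 * N + 1) (N + 1) := by
    rw [← hQ2, ← Q_add]; congr 1; ring
  have hq := PowerSeries.mul_inv_cancel _ (cc_Q N)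
  have hp := PowerSeries.mul_inv_cancel _ (cc_Pa (N + 1) N (by simp))
  have hv := PowerSeries.mul_inv_cancel _ (cc_pow 1 (by simp))
  have hw := PowerSeries.mul_inv_cancel _ (cc_pow 2 (by simp))
  rw [pow_one] at hv
  have hSN := Sa_mul N
  have hSN1 := Sa_mul (N + 1)
  have hTN := Ta_mul N
  obtain ⟨c, hc⟩ := Pa_one (2 * N + 1) (N + 1)
  obtain ⟨d, hd⟩ := Pa_two (N + 1) N
  have hB := two_sq (X ^ (N + 1)) (Sa N) (Ta N) d (Pa (N + 1) N) (by rw [hd]; ring)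
  rw [hQ3, hQ2]
  simp only [pow_succ (_ * _ : PowerSeries ℚ), pow_succ (1 - X : PowerSeries ℚ), pow_zero, one_mul, PowerSeries.mul_inv_rev]
  generalize Pa (N + 1) N = P at *
  generalize Pa (2 * N + 1) (N + 1) = R at *
  generalize P⁻¹ = P' at *
  generalize (1 - (X : PowerSeries ℚ) ^ (N + 1))⁻¹ = i at *
  generalize (1 - (X : PowerSeries ℚ) ^ 2)⁻¹ = w at *
  generalize (1 - (X : PowerSeries ℚ))⁻¹ = v at *
  generalize Q N = q at *
  generalize q⁻¹ = q' at *
  have eSN : Sa N = (1 - X ^ N) * v := by linear_combination v * hSN - Sa N * hv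
  have eSN1 : Sa (N + 1) = (1 - X ^ (N + 1)) * v := by
    linear_combination v * hSN1 - Sa (N + 1) * hv
  have eTN : Ta N = (1 - X ^ (2 * N)) * w := by linear_combination w * hTN - Ta N * hw
  rw [eSN, eTN] at hB
  rw [eSN1] at hc
  obtain ⟨b, hb⟩ := hB
  set A : PowerSeries ℚ := 1 - X ^ (2 * N + 1) * v with hA
  set B : PowerSeries ℚ := 1 + 2 * (X ^ (N + 1) - X ^ (2 * N + 1)) * v + 2 * X ^ (2 * N + 2) * (v * v)
    + X ^ (2 * N + 2) * w with hBd
  have hRA : X ^ (3 * N + 1) ∣ R - A :=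
    ⟨X * v + X ^ (N + 1) * c, by rw [hc, hA]; ring⟩
  have hPB : X ^ (3 * N + 1) ∣ P ^ 2 * B - 1 := by
    refine ⟨X ^ 2 * b + P ^ 2 * (2 * X * (2 - X ^ N) * v ^ 2 + X * X ^ N * w), ?_⟩
    rw [hBd]
    linear_combination hb
  have key : q * P * R * (q * q * q) * 1 = q * P * R * (q * q * q) := by ring
  have fin : q * P * R * q ^ 3 * (i * (P' * q' * (P' * q' * (P' * q')))) - q * i * A * B
      = q * i * (P' ^ 2 * (R - A) - A * P' ^ 2 * (P ^ 2 * B - 1)) := by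
    have h1 : q ^ 3 * q' ^ 3 = 1 := by rw [← mul_pow, hq, one_pow]
    have h2 : P ^ 2 * P' ^ 2 = 1 := by rw [← mul_pow, hp, one_pow]
    linear_combination q * P * R * i * P' ^ 3 * h1 + q * R * i * P' ^ 2 * hp + q * i * A * B * h2
  have goal := (((hRA.mul_left (P' ^ 2)).sub (hPB.mul_left (A * P' ^ 2))).mul_left (q * i))
  rw [← fin] at goal
  convert goal using 1
end

section
/- For every integer N ≥ 1, in ℚ⟦u⟧ one has (Q_N(u)/(1 − u^{N+1})) · (1 − u^{2N+1}/(1 − u)) · (1 + 2(u^{N+1} − u^{2N+1})/(1 − u) + 2u^{2N+2}/(1 − u)^2 + u^{2N+2}/(1 − u^2)) − Q_{3N}(u) − u^{N+1} · Q_{3N}(u) · (1 + 3/(1 − u)) ≡ u^{2N+1} · Q_N(u) · (−3 + 10u + 5u^2 − 4u^3 + u^4)/((1 − u)(1 − u^2)) (mod u^{3N+1}), where Q_M(u) = ∏_{k=1}^M (1 − u^k). (This is the q-series content of equations (3.5)–(3.6): subtracting the head (−1)^N{3N}! and the shifted 1-head from the normalized colored Jones polynomial of a pretzel knot with three negative twist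 regions each having at least three half-twists leaves, in the window of the first 3N+1 coefficients, exactly the series whose first N coefficients give the 2-head H_{2,−9_{35}}(q) = ∏_{i≥1}(1−q^{−i})·(−3+10q^{−1}+5q^{−2}−4q^{−3}+q^{−4})/((1−q^{−1})(1−q^{−2})) with u = q^{−1}.) -/
open PowerSeries

lemma Q_aux (N m : ℕ) : ∃ c : PowerSeries ℚ,
    (1 - X) * (1 - X ^ 2) * Q (N + m) = Q N * ((1 - X) * (1 - X ^ 2)
      - (1 - X ^ 2) * (X * X ^ N) * (1 - X ^ m)
      + (X ^ N) ^ 2 * X ^ 2 * (1 - X ^ m) * (X - X ^ m) + (X ^ N) ^ 3 * X * c) := by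
  induction m with
  | zero => exact ⟨0, by simp; ring⟩
  | succ m ih =>
    obtain ⟨c, hc⟩ := ih
    have hQ : Q (N + (m + 1)) = Q (N + m) * (1 - X ^ N * X ^ m * X) := by
      unfold Q
      rw [← add_assoc, Finset.prod_Icc_succ_top (by omega)]
      ring
    refine ⟨c * (1 - X ^ N * X ^ m * X) - X ^ 2 * X ^ m * (1 - X ^ m) * (X - X ^ m), ?_⟩
    rw [hQ, pow_succ X m]
    generalize (X : PowerSeries ℚ) ^ N = a at *
    generalize (X : PowerSeries ℚ) ^ m = b at *
    linear_combination (1 - a * b * X) * hc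

lemma ring_aux {R : Type*} [CommRing R] (u A B : R)
    (hA : (1 - u) * A = 1) (hB : (1 - u ^ 2) * B = 1) :
    u ^ 2 - u * A + 2 * u ^ 2 * A - 2 * u * A + 2 * u ^ 2 * A ^ 2 + u ^ 2 * B
      - u ^ 3 * (A * B) + u ^ 2 * A * (1 + 3 * A)
      = u * (-3 + 10 * u + 5 * u ^ 2 - 4 * u ^ 3 + u ^ 4) * (A * B) := by
  grind

lemma P_aux (N : ℕ) (A B : PowerSeries ℚ)
    (hA : (1 - X) * A = 1) (hB : (1 - X ^ 2) * B = 1) : ∃ c : PowerSeries ℚ,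
    Q (3 * N) = Q N * (1 - X * X ^ N * A + (X ^ N) ^ 2 * X ^ 3 * (A * B)
      + (X ^ N) ^ 3 * X * c) := by
  obtain ⟨c, hc⟩ := Q_aux N (2 * N)
  rw [show N + 2 * N = 3 * N by ring, show (X : PowerSeries ℚ) ^ (2 * N) = (X ^ N) ^ 2 by ring] at hc
  generalize (X : PowerSeries ℚ) ^ N = a at *
  refine ⟨A + A * B * (a * X * (a ^ 2 - 1 - X) + c), ?_⟩
  have h1 : (1 - X) * (1 - X ^ 2) * (A * B) = 1 := by
    linear_combination (1 - X ^ 2) * B * hA + hB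
  generalize Q N = q at *
  linear_combination (A * B) * hc + (q - Q (3 * N)) * h1 
    - q * X * a * (1 - a ^ 2) * A * hB

/-- Equations (3.5)–(3.6): for N ≥ 1, subtracting the head and the shifted 1-head from
the normalized colored Jones polynomial of a (3⁺,3⁺,3⁺) pretzel knot leaves, modulo
u^{3N+1}, exactly u^{2N+1} Q_N (−3 + 10u + 5u² − 4u³ + u⁴)/((1 − u)(1 − u²)). -/
theorem two_head_base_case (N : ℕ) (hN : 1 ≤ N) :
    (X : PowerSeries ℚ) ^ (3 * N + 1) ∣
      Q N * (1 - (X : PowerSeries ℚ) ^ (N + 1))⁻¹ *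
          (1 - X ^ (2 * N + 1) * (1 - X)⁻¹) *
          (1 + 2 * (X ^ (N + 1) - X ^ (2 * N + 1)) * (1 - X)⁻¹
            + 2 * X ^ (2 * N + 2) * ((1 - X) ^ 2)⁻¹
            + X ^ (2 * N + 2) * (1 - X ^ 2)⁻¹)
        - Q (3 * N)
        - X ^ (N + 1) * Q (3 * N) * (1 + 3 * (1 - X)⁻¹)
        - X ^ (2 * N + 1) * Q N *
            (-3 + 10 * X + 5 * X ^ 2 - 4 * X ^ 3 + X ^ 4) *
            ((1 - X) * (1 - X ^ 2))⁻¹ := by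
  have hA : (1 - X) * (1 - X : PowerSeries ℚ)⁻¹ = 1 := PowerSeries.mul_inv_cancel _ (by simp)
  have hB : (1 - X ^ 2) * (1 - X ^ 2 : PowerSeries ℚ)⁻¹ = 1 :=
    PowerSeries.mul_inv_cancel _ (by simp)
  have hC : (1 - X ^ (N + 1)) * (1 - X ^ (N + 1) : PowerSeries ℚ)⁻¹ = 1 :=
    PowerSeries.mul_inv_cancel _ (by simp)
  have e1 : ((1 - X : PowerSeries ℚ) ^ 2)⁻¹ = (1 - X)⁻¹ ^ 2 := by
    rw [sq, PowerSeries.mul_inv_rev, sq]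
  rw [e1, PowerSeries.mul_inv_rev]
  generalize (1 - X : PowerSeries ℚ)⁻¹ = A at *
  generalize (1 - X ^ 2 : PowerSeries ℚ)⁻¹ = B at *
  generalize (1 - X ^ (N + 1) : PowerSeries ℚ)⁻¹ = C at *
  obtain ⟨c, hc⟩ := P_aux N A B hA hB
  rw [hc]
  have hR := ring_aux X A B hA hB
  rw [show (X : PowerSeries ℚ) ^ (3 * N + 1) = (X ^ N) ^ 3 * X by ring,
    show (X : PowerSeries ℚ) ^ (2 * N + 1) = (X ^ N) ^ 2 * X by ring,
    show (X : PowerSeries ℚ) ^ (2 * N + 2) = (X ^ N) ^ 2 * X ^ 2 by ring,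
    show (X : PowerSeries ℚ) ^ (N + 1) = X ^ N * X by ring] at *
  generalize (X : PowerSeries ℚ) ^ N = a at *
  generalize Q N = q at *
  generalize (X : PowerSeries ℚ) = u at *
  have hC' : C = 1 + a * u + a ^ 2 * u ^ 2 + a ^ 3 * u ^ 3 * C := by
    linear_combination (1 + a * u + a ^ 2 * u ^ 2) * hC
  obtain ⟨w, hw⟩ : ∃ w, w = -2 * A + 2 * u * A ^ 2 + u * B := ⟨_, rfl⟩
  obtain ⟨YZ, hYZ⟩ : ∃ YZ, YZ = (1 - a ^ 2 * u * A) * (1 + 2 * u * a * A + a ^ 2 * u * w) :=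
    ⟨_, rfl⟩
  refine ⟨q * (u ^ 2 * C * YZ
    + (-2 * u * A ^ 2 + u * (w - A) + u ^ 2 * (2 * A))
    + a * (-u * A * w + u * (-2 * u * A ^ 2) + u ^ 2 * (w - A))
    + a ^ 2 * (u * (-u * A * w) + u ^ 2 * (-2 * u * A ^ 2))
    + a ^ 3 * (u ^ 2 * (-u * A * w))
    - u ^ 3 * (A * B) * (1 + 3 * A) - c * (1 + a * u * (1 + 3 * A))), ?_⟩
  subst hYZ hw
  linear_combination q * (1 - a ^ 2 * u * A) * (1 + 2 * u * a * A
    + a ^ 2 * u * (-2 * A + 2 * u * A ^ 2 + u * B)) * hC' + q * a ^ 2 * hR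
end

section
/- For every integer N ≥ 2, in ℚ⟦u⟧ one has Q_{3N}(u) · Q_N(u)^3 / ((1 − u) · Q_{2N−2}(u) · Q_{2N}(u)^2 · (1 − u^{2N})) ≡ (Q_N(u)/(1 − u)) · (1 + 2u^{N+1}/(1 − u) − u^{2N−1}/(1 − u)) (mod u^{2N}), where Q_M(u) = ∏_{k=1}^M (1 − u^k). (This is the q-series content of Lemma 3.1: it computes, up to the normalization {M}! = (−1)^M A^{−M(M+1)} Q_M(u) with u = q^{−1} = A^4, the first 2N highest coefficients of the normalized skein summand S̄_{N−1,N,N} = {3N}!{N}!^3/({1}{2N−2}!{2N}!^2{2N}).) -/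
open PowerSeries

lemma Q_succ_aux (M : ℕ) : Q (M + 1) = Q M * (1 - X ^ (M + 1)) := by
  unfold Q
  rw [Finset.prod_Icc_succ_top (by omega)]

lemma Q_const_aux (M : ℕ) : constantCoeff (Q M) = 1 := by
  induction M with
  | zero => simp [Q]
  | succ k ih => rw [Q_succ_aux]; simp [ih]

lemma Q_high_aux {R : Type*} [CommRing R] (φ : PowerSeries ℚ →+* R) (n : ℕ)
    (h : φ X ^ n = 0) (j : ℕ) : φ (Q (n + j)) = φ (Q n) := by
  induction j with
  | zero => rfl
  | succ k ih =>
    rw [← add_assoc, Q_succ_aux, map_mul, ih]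
    have : φ X ^ (n + k + 1) = 0 := pow_eq_zero_of_le (by omega) h
    simp [this]

lemma Q_mid_aux {R : Type*} [CommRing R] (φ : PowerSeries ℚ →+* R) (N : ℕ)
    (h : φ X ^ (2 * N) = 0) (a : R) (ha : (1 - φ X) * a = 1) (j : ℕ) :
    φ (Q (N + j)) = φ (Q N) * (1 - (φ X ^ (N + 1) - φ X ^ (N + j + 1)) * a) := by
  induction j with
  | zero => simp
  | succ k ih =>
    rw [← add_assoc, Q_succ_aux, map_mul, ih]
    have h1 : φ X ^ (N + k + 1) * φ X ^ (N + 1) = 0 := by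
      rw [← pow_add]; exact pow_eq_zero_of_le (by omega) h
    have h2 : φ X ^ (N + k + 1) * φ X ^ (N + k + 1) = 0 := by
      rw [← pow_add]; exact pow_eq_zero_of_le (by omega) h
    simp only [map_sub, map_one, map_pow]
    rw [pow_succ (φ X) (N + k + 1)]
    generalize φ X ^ (N + k + 1) = m at *
    generalize φ X ^ (N + 1) = t at *
    linear_combination φ (Q N) * (a * h1 - a * h2 + m * ha)

/-- Lemma 3.1 (q-series content): for N ≥ 2,
Q_{3N} Q_N^3 / ((1 − u) Q_{2N−2} Q_{2N}^2 (1 − u^{2N})) ≡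
(Q_N/(1 − u)) (1 + 2u^{N+1}/(1 − u) − u^{2N−1}/(1 − u))  (mod u^{2N}). -/
theorem summand_N_minus_one_congr (N : ℕ) (hN : 2 ≤ N) :
    (X : PowerSeries ℚ) ^ (2 * N) ∣
      Q (3 * N) * Q N ^ 3 *
          ((1 - (X : PowerSeries ℚ)) * Q (2 * N - 2) * Q (2 * N) ^ 2 *
            (1 - (X : PowerSeries ℚ) ^ (2 * N)))⁻¹ -
        Q N * (1 - (X : PowerSeries ℚ))⁻¹ *
          (1 + 2 * X ^ (N + 1) * (1 - X)⁻¹ - X ^ (2 * N - 1) * (1 - X)⁻¹) := by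
  have hX : (1 - (X : PowerSeries ℚ)) * (1 - X)⁻¹ = 1 :=
    PowerSeries.mul_inv_cancel _ (by simp)
  set D := (1 - (X : PowerSeries ℚ)) * Q (2 * N - 2) * Q (2 * N) ^ 2 *
            (1 - (X : PowerSeries ℚ) ^ (2 * N)) with hD
  have hDD : D * D⁻¹ = 1 := by
    apply PowerSeries.mul_inv_cancel
    have : (2 * N) ≠ 0 := by omega
    simp [hD, Q_const_aux, this]
  generalize hA : (1 - (X : PowerSeries ℚ))⁻¹ = A at *
  rw [← Ideal.mem_span_singleton, ← Ideal.Quotient.eq_zero_iff_mem]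
  set φ := Ideal.Quotient.mk (Ideal.span {(X : PowerSeries ℚ) ^ (2 * N)}) with hφ
  have h0 : φ X ^ (2 * N) = 0 := by
    rw [← map_pow, hφ, Ideal.Quotient.eq_zero_iff_mem]
    exact Ideal.mem_span_singleton_self _
  have ha : (1 - φ X) * φ A = 1 := by simpa using congrArg φ hX
  have hd := congrArg φ hDD
  have h3 := Q_high_aux φ (2 * N) h0 N
  have h2 := Q_mid_aux φ N h0 _ ha N
  have e3 : 2 * N + N = 3 * N := by ring
  have e2 : N + N = 2 * N := by ring
  rw [e3] at h3
  rw [e2] at h2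
  have h2' : φ (Q (2 * N)) = φ (Q (2 * N - 2)) * (1 - φ X ^ (2 * N - 1)) := by
    obtain ⟨k, rfl⟩ : ∃ k, N = k + 1 := ⟨N - 1, by omega⟩
    have e : 2 * (k + 1) = 2 * k + 1 + 1 := by ring
    have h0' : φ X ^ (2 * k + 1 + 1) = 0 := by rw [← e]; exact h0
    have e4 : 2 * (k + 1) - 2 = 2 * k := by omega
    have e5 : 2 * (k + 1) - 1 = 2 * k + 1 := by omega
    have e6 : Q (2 * (k + 1)) = Q (2 * k + 1 + 1) := congrArg Q e
    rw [e4, e5, e6, Q_succ_aux, Q_succ_aux]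
    simp [h0']
  have hn : φ X ^ (2 * N + 1) = 0 := pow_eq_zero_of_le (by omega) h0
  have htt : φ X ^ (N + 1) * φ X ^ (N + 1) = 0 := by
    rw [← pow_add]; exact pow_eq_zero_of_le (by omega) h0
  have htr : φ X ^ (N + 1) * φ X ^ (2 * N - 1) = 0 := by
    rw [← pow_add]; exact pow_eq_zero_of_le (by omega) h0
  have hra : φ X ^ (2 * N - 1) * φ A = φ X ^ (2 * N - 1) := by
    have : φ X ^ (2 * N - 1) * φ X = 0 := by
      rw [← pow_succ]; exact pow_eq_zero_of_le (by omega) h0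
    linear_combination φ X ^ (2 * N - 1) * ha + φ A * this
  have hDφ : φ D = (1 - φ X) * φ (Q (2 * N - 2)) * φ (Q (2 * N)) ^ 2 := by
    simp [hD, h0]
  rw [hn, sub_zero] at h2
  simp only [map_sub, map_mul, map_add, map_pow, map_one, map_ofNat] at hd ⊢
  rw [hra, h3]
  generalize φ D⁻¹ = d at *
  rw [hDφ] at hd
  clear hDφ h3 hra hn h0
  generalize φ (Q (2 * N - 2)) = q' at *
  generalize φ (Q (2 * N)) = q2 at *
  generalize φ (Q N) = q at *
  generalize φ A = a at *
  generalize φ X ^ (2 * N - 1) = r at *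
  generalize φ X ^ (N + 1) = t at *
  generalize φ X = x at *
  have key : q2 * q ^ 3 = q * (1 + 2 * t * a - r) * q' * q2 ^ 2 := by
    have s1 : q * (1 + 2 * t * a - r) * q' * q2 ^ 2 = q * (1 + 2 * t * a) * q2 ^ 3 := by
      linear_combination (-q * (1 + 2 * t * a) * q2 ^ 2) * h2' + 2 * a * q * q' * q2 ^ 2 * htr
    have s2 : q2 ^ 2 * (1 + 2 * t * a) = q ^ 2 := by
      rw [h2]
      linear_combination q ^ 2 * a ^ 2 * (2 * t * a - 3) * htt
    rw [s1]
    linear_combination (-q * q2) * s2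
  linear_combination d * key - d * q * (1 + 2 * t * a - r) * q' * q2 ^ 2 * ha + q * a * (1 + 2 * t * a - r) * hd
end

section
/- For every integer N ≥ 2, in ℚ⟦u⟧ one has (−3 + 10u + 5u^2 − 4u^3 + u^4)/((1 − u)(1 − u^2)) − 6u/(1 − u)^2 + 2u^{N−1}/(1 − u)^2 + 2/((1 − u)(1 − u^2)) − 2u^{N−1}/((1 − u)(1 − u^2)(1 − u^3)) + u^2(1 − u^{N−1})/(1 − u)^2 ≡ (−1 + 4u − 3u^3 + u^4)/((1 − u)(1 − u^2)) (mod u^N). (This is the q-series content of the computation (3.8)–(3.9) in Section 3.4, with u = q^{−1} and the common unit factor ∏_{i≥1}(1 − u^i) cancelled: it shows that the 2-head of any pretzel knot in the family (3^+,1,1) is ∏_{i≥1}(1−q^{−i})·(−1+4q^{−1}−3q^{−3}+q^{−4})/((1−q^{−1})(1−q^{−2})).) -/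
open PowerSeries

/-- The computation (3.8)–(3.9) of Section 3.4: for N ≥ 2, in ℚ⟦u⟧,
(−3 + 10u + 5u² − 4u³ + u⁴)/((1 − u)(1 − u²)) − 6u/(1 − u)² + 2u^{N−1}/(1 − u)²
 + 2/((1 − u)(1 − u²)) − 2u^{N−1}/((1 − u)(1 − u²)(1 − u³)) + u²(1 − u^{N−1})/(1 − u)²
≡ (−1 + 4u − 3u³ + u⁴)/((1 − u)(1 − u²))  (mod u^N). -/
theorem two_head_311_congr (N : ℕ) (hN : 2 ≤ N) :
    (X : PowerSeries ℚ) ^ N ∣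
      (-3 + 10 * (X : PowerSeries ℚ) + 5 * X ^ 2 - 4 * X ^ 3 + X ^ 4) *
          ((1 - X) * (1 - X ^ 2))⁻¹
        - 6 * X * ((1 - X) ^ 2)⁻¹
        + 2 * X ^ (N - 1) * ((1 - X) ^ 2)⁻¹
        + 2 * ((1 - X) * (1 - X ^ 2))⁻¹
        - 2 * X ^ (N - 1) * ((1 - X) * (1 - X ^ 2) * (1 - X ^ 3))⁻¹
        + X ^ 2 * (1 - X ^ (N - 1)) * ((1 - X) ^ 2)⁻¹
        - (-1 + 4 * X - 3 * X ^ 3 + X ^ 4) * ((1 - X) * (1 - X ^ 2))⁻¹ := by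
  obtain ⟨M, rfl⟩ : ∃ M, N = M + 1 := ⟨N - 1, by omega⟩
  have hc : ((1 - X) * (1 - X ^ 2) * (1 - X ^ 3) : PowerSeries ℚ) *
      ((1 - X) * (1 - X ^ 2) * (1 - X ^ 3))⁻¹ = 1 :=
    PowerSeries.mul_inv_cancel _ (by simp)
  have hb : ((1 - X) * (1 - X ^ 2) : PowerSeries ℚ)⁻¹ =
      (1 - X ^ 3) * ((1 - X) * (1 - X ^ 2) * (1 - X ^ 3))⁻¹ := by
    symm
    rw [PowerSeries.eq_inv_iff_mul_eq_one (by simp)]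
    linear_combination hc
  have ha : ((1 - X) ^ 2 : PowerSeries ℚ)⁻¹ =
      (1 + X) * (1 - X ^ 3) * ((1 - X) * (1 - X ^ 2) * (1 - X ^ 3))⁻¹ := by
    symm
    rw [PowerSeries.eq_inv_iff_mul_eq_one (by simp)]
    linear_combination hc
  rw [ha, hb, Nat.add_sub_cancel]
  generalize ((1 - X) * (1 - X ^ 2) * (1 - X ^ 3) : PowerSeries ℚ)⁻¹ = c
  exact ⟨2 * c * (1 - X ^ 2 - X ^ 3) - X * (1 + X) * (1 - X ^ 3) * c, by ring⟩
end

section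
/- For every integer N ≥ 2, in ℚ⟦u⟧ one has (−3 + 10u + 5u^2 − 4u^3 + u^4)/((1 − u)(1 − u^2)) − 9u/(1 − u)^2 + 3u^{N−1}/(1 − u)^2 + 3/((1 − u)(1 − u^2)) − 3u^{N−1}/((1 − u)(1 − u^2)(1 − u^3)) + 3u^2(1 − u^{N−1})/(1 − u)^2 ≡ u (mod u^N). (This is the q-series content of the Section 3.5 computation for the trefoil, the (1,1,1) pretzel knot, with u = q^{−1} and the common unit factor ∏_{i≥1}(1 − u^i) cancelled: after the shift by one power of u it shows that the 2-head of the trefoil is H_{2,3_1}(q) = ∏_{i≥1}(1 − q^{−i}).) -/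
open PowerSeries

/-- The Section 3.5 computation for the trefoil: for N ≥ 2, in ℚ⟦u⟧,
(−3 + 10u + 5u² − 4u³ + u⁴)/((1 − u)(1 − u²)) − 9u/(1 − u)² + 3u^{N−1}/(1 − u)²
 + 3/((1 − u)(1 − u²)) − 3u^{N−1}/((1 − u)(1 − u²)(1 − u³)) + 3u²(1 − u^{N−1})/(1 − u)²
≡ u  (mod u^N). -/
theorem two_head_trefoil_congr (N : ℕ) (hN : 2 ≤ N) :
    (X : PowerSeries ℚ) ^ N ∣
      (-3 + 10 * (X : PowerSeries ℚ) + 5 * X ^ 2 - 4 * X ^ 3 + X ^ 4) *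
          ((1 - X) * (1 - X ^ 2))⁻¹
        - 9 * X * ((1 - X) ^ 2)⁻¹
        + 3 * X ^ (N - 1) * ((1 - X) ^ 2)⁻¹
        + 3 * ((1 - X) * (1 - X ^ 2))⁻¹
        - 3 * X ^ (N - 1) * ((1 - X) * (1 - X ^ 2) * (1 - X ^ 3))⁻¹
        + 3 * X ^ 2 * (1 - X ^ (N - 1)) * ((1 - X) ^ 2)⁻¹
        - X := by
  obtain ⟨M, rfl⟩ : ∃ M, N = M + 1 := ⟨N - 1, by omega⟩
  have hc : ((1 - X) * (1 - X ^ 2) * (1 - X ^ 3)) *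
      ((1 - X) * (1 - X ^ 2) * (1 - X ^ 3) : PowerSeries ℚ)⁻¹ = 1 :=
    PowerSeries.mul_inv_cancel _ (by simp)
  have hb : ((1 - X) * (1 - X ^ 2) : PowerSeries ℚ)⁻¹ =
      (1 - X ^ 3) * ((1 - X) * (1 - X ^ 2) * (1 - X ^ 3) : PowerSeries ℚ)⁻¹ := by
    rw [eq_comm, PowerSeries.eq_inv_iff_mul_eq_one (by simp)]
    linear_combination hc
  have ha : ((1 - X) ^ 2 : PowerSeries ℚ)⁻¹ =
      (1 + X) * (1 - X ^ 3) * ((1 - X) * (1 - X ^ 2) * (1 - X ^ 3) : PowerSeries ℚ)⁻¹ := by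
    rw [eq_comm, PowerSeries.eq_inv_iff_mul_eq_one (by simp)]
    linear_combination hc
  rw [ha, hb]
  generalize ((1 - X) * (1 - X ^ 2) * (1 - X ^ 3) : PowerSeries ℚ)⁻¹ = c at hc
  rw [Nat.add_sub_cancel]
  refine ⟨3 * (1 - X - 2 * X ^ 2 - X ^ 3 + X ^ 4 + X ^ 5) * c, ?_⟩
  linear_combination X * hc
end

section
/- For every integer N ≥ 1, in ℚ⟦u⟧ one has ∏_{k=N+1}^{2N} (1 − u^k) ≡ 1 − Σ_{i=1}^{N} u^{N+i} + Σ_{1 ≤ l < k ≤ N} u^{2N+k+l} (mod u^{3N+1}). (This is the key intermediate congruence in the proof of Lemma 2.3: modulo u^{3N+1}, only the contributions of at most two of the factors (1 − u^{N+i}) survive when the product is expanded.) -/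
open PowerSeries

lemma aux_congr (N m : ℕ) :
    (X : PowerSeries ℚ) ^ (3 * N + 1) ∣
      (∏ k ∈ Finset.Icc (N + 1) (N + m), (1 - (X : PowerSeries ℚ) ^ k)) -
        (1 - (∑ i ∈ Finset.Icc 1 m, (X : PowerSeries ℚ) ^ (N + i))
          + ∑ k ∈ Finset.Icc 1 m, ∑ l ∈ Finset.Ico 1 k,
              (X : PowerSeries ℚ) ^ (2 * N + k + l)) := by
  induction m with
  | zero => simp
  | succ m ih =>
    rw [← add_assoc, Finset.prod_Icc_succ_top (by omega), Finset.sum_Icc_succ_top (by omega),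
      Finset.sum_Icc_succ_top (by omega)]
    have hT : (X : PowerSeries ℚ) ^ (2 * N) ∣ ∑ k ∈ Finset.Icc 1 m, ∑ l ∈ Finset.Ico 1 k,
              (X : PowerSeries ℚ) ^ (2 * N + k + l) :=
      Finset.dvd_sum fun k _ => Finset.dvd_sum fun l _ => pow_dvd_pow _ (by omega)
    have hS : ∑ l ∈ Finset.Ico 1 (m + 1), (X : PowerSeries ℚ) ^ (2 * N + (m + 1) + l)
        = (∑ i ∈ Finset.Icc 1 m, (X : PowerSeries ℚ) ^ (N + i)) * X ^ (N + m + 1) := by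
      rw [Finset.sum_mul]
      refine Finset.sum_congr (by ext; simp) fun i _ => ?_
      rw [← pow_add]
      congr 1
      omega
    rw [hS]
    have hx : (X : PowerSeries ℚ) ^ (3 * N + 1) ∣ X ^ (N + m + 1) *
        ∑ k ∈ Finset.Icc 1 m, ∑ l ∈ Finset.Ico 1 k, (X : PowerSeries ℚ) ^ (2 * N + k + l) := by
      refine dvd_trans ?_ (mul_dvd_mul_left _ hT)
      rw [← pow_add]
      exact pow_dvd_pow _ (by omega)
    have h := dvd_sub (ih.mul_right (1 - (X : PowerSeries ℚ) ^ (N + m + 1))) hx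
    convert h using 1
    rw [← add_assoc N m 1]
    ring

/-- The key intermediate congruence in the proof of Lemma 2.3: for N ≥ 1, in ℚ⟦u⟧,
∏_{k=N+1}^{2N} (1 − u^k) ≡ 1 − Σ_{i=1}^{N} u^{N+i} + Σ_{1 ≤ l < k ≤ N} u^{2N+k+l}
(mod u^{3N+1}). -/
theorem two_N_factorial_intermediate_congr (N : ℕ) (hN : 1 ≤ N) :
    (X : PowerSeries ℚ) ^ (3 * N + 1) ∣
      (∏ k ∈ Finset.Icc (N + 1) (2 * N), (1 - (X : PowerSeries ℚ) ^ k)) -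
        (1 - (∑ i ∈ Finset.Icc 1 N, (X : PowerSeries ℚ) ^ (N + i))
          + ∑ k ∈ Finset.Icc 1 N, ∑ l ∈ Finset.Ico 1 k,
              (X : PowerSeries ℚ) ^ (2 * N + k + l)) := by
  have h := aux_congr N N
  rwa [← two_mul] at h
end
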